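/- Under the stated hypotheses, let ρ ∈ ℕ, let U be a real symmetric positive definite n×n matrix, and suppose Y ∈ ℝ^{ρdn×ρdn} symmetric and X = [X₁ ⋯ X_d] ∈ ℝ^{n×ρdn} (with blocks X_i ∈ ℝ^{n×ρn}) satisfy that the block matrix [[U, −X], [−Xᵀ, Y]] is positive semidefinite. Set X̂ := Col(X₁, …, X_d), W := ∫_K ϖ(τ) (f(τ)ᵀ ⊗ I_{ρn}) Y (f(τ) ⊗ I_{ρn}) dτ, and F := W₀⁻¹. If Υ ∈ ℝ^{dn×ρn} and z ∈ ℝ^{ρn} satisfy Υ z = ϑ, then zᵀ (Υᵀ X̂ + X̂ᵀ Υ − W) z ≤ ϑᵀ (F ⊗ U) ϑ; that is, the lower bound of the free-matrix inequality never exceeds the lower bound ϑᵀ (F ⊗ U) ϑ of the weighted integral inequality. -/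

import Mathlib

open MeasureTheory Matrix
open scoped Kronecker

/-- `Fₙ(τ) = f(τ) ⊗ Iₙ ∈ ℝ^{dn×n}`. -/
noncomputable def kronColId (d n : ℕ) (f : ℝ → Fin d → ℝ) (τ : ℝ) :
    Matrix (Fin d × Fin n) (Fin n) ℝ :=
  Matrix.of fun p j => f τ p.1 * (1 : Matrix (Fin n) (Fin n) ℝ) p.2 j

/-- `f(τ) ⊗ I_{ρn} ∈ ℝ^{dρn×ρn}`. -/
noncomputable def kronColIdRho (d n ρ : ℕ) (f : ℝ → Fin d → ℝ) (τ : ℝ) :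
    Matrix (Fin d × (Fin ρ × Fin n)) (Fin ρ × Fin n) ℝ :=
  Matrix.of fun p q => f τ p.1 * (1 : Matrix (Fin ρ × Fin n) (Fin ρ × Fin n) ℝ) p.2 q

theorem aux_quad (d : ℕ) (K : Set ℝ)
    (ϖ : ℝ → ℝ) (hϖ0 : ∀ τ, 0 ≤ ϖ τ) (f : ℝ → Fin d → ℝ)
    (hint : ∀ i k, Integrable (fun τ => ϖ τ * (f τ i * f τ k)) (volume.restrict K))
    (C : Fin d → Fin d → ℝ) (hC : ∀ g : Fin d → ℝ, 0 ≤ ∑ i, ∑ k, g i * g k * C i k) :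
    0 ≤ ∑ i, ∑ k, (∫ τ in K, ϖ τ * (f τ i * f τ k)) * C i k := by
  have h : ∑ i, ∑ k, (∫ τ in K, ϖ τ * (f τ i * f τ k)) * C i k
      = ∫ τ in K, ∑ i, ∑ k, ϖ τ * (f τ i * f τ k) * C i k := by
    rw [integral_finsetSum]
    · refine Finset.sum_congr rfl fun i _ => ?_
      rw [integral_finsetSum]
      · refine Finset.sum_congr rfl fun k _ => ?_
        rw [integral_mul_const]
      · exact fun k _ => (hint i k).mul_const _
    · exact fun i _ => integrable_finsetSum _ fun k _ => (hint i k).mul_const _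
  rw [h]
  refine integral_nonneg fun τ => ?_
  have := mul_nonneg (hϖ0 τ) (hC (f τ))
  simp only [Finset.mul_sum] at this
  simpa only [mul_assoc, Pi.zero_apply] using this

theorem aux_int (d : ℕ) (K : Set ℝ)
    (ϖ : ℝ → ℝ) (hϖ : Measurable ϖ) (hϖ0 : ∀ τ, 0 ≤ ϖ τ)
    (f : ℝ → Fin d → ℝ) (hf : Measurable f)
    (hfi : IntegrableOn (fun τ => ϖ τ * ‖f τ‖ ^ 2) K) (i k : Fin d) :
    Integrable (fun τ => ϖ τ * (f τ i * f τ k)) (volume.restrict K) := by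
  refine Integrable.mono' hfi ?_ (Filter.Eventually.of_forall fun τ => ?_)
  · have h1 : Measurable fun τ => f τ i := (measurable_pi_apply i).comp hf
    have h2 : Measurable fun τ => f τ k := (measurable_pi_apply k).comp hf
    exact (hϖ.mul (h1.mul h2)).aestronglyMeasurable
  · rw [norm_mul, Real.norm_of_nonneg (hϖ0 τ), norm_mul, pow_two]
    have := hϖ0 τ
    gcongr
    · exact norm_le_pi_norm (f τ) i
    · exact norm_le_pi_norm (f τ) k

/-- If `[[U, −X], [−Xᵀ, Y]] ⪰ 0` with `U ≻ 0` and `Υ z = ϑ`, then the free-matrix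
lower bound never exceeds the weighted-inequality bound:
`zᵀ (Υᵀ X̂ + X̂ᵀ Υ − W) z ≤ ϑᵀ (W₀⁻¹ ⊗ U) ϑ`. -/
theorem free_matrix_bound_le_weighted_bound (d n ρ : ℕ) (K : Set ℝ)
    (hK : MeasurableSet K)
    (ϖ : ℝ → ℝ) (hϖ : Measurable ϖ) (hϖ0 : ∀ τ, 0 ≤ ϖ τ)
    (f : ℝ → Fin d → ℝ) (hf : Measurable f)
    (hfi : IntegrableOn (fun τ => ϖ τ * ‖f τ‖ ^ 2) K)
    (W₀ : Matrix (Fin d) (Fin d) ℝ)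
    (hW₀ : W₀ = Matrix.of fun i j => ∫ τ in K, ϖ τ * (f τ i * f τ j))
    (hW₀pd : W₀.PosDef)
    (x : ℝ → Fin n → ℝ) (hx : Measurable x)
    (hxi : IntegrableOn (fun τ => ϖ τ * ‖x τ‖ ^ 2) K)
    (ϑ : Fin d × Fin n → ℝ)
    (hϑ : ϑ = fun p => ∫ τ in K, ϖ τ * ((kronColId d n f τ *ᵥ x τ) p))
    (U : Matrix (Fin n) (Fin n) ℝ) (hU : U.PosDef)
    (Y : Matrix (Fin d × (Fin ρ × Fin n)) (Fin d × (Fin ρ × Fin n)) ℝ)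
    (hY : Y.IsSymm)
    (Xb : Fin d → Matrix (Fin n) (Fin ρ × Fin n) ℝ)
    (X : Matrix (Fin n) (Fin d × (Fin ρ × Fin n)) ℝ)
    (hX : X = Matrix.of fun i q => Xb q.1 i q.2)
    (hblock : (Matrix.fromBlocks U (-X) (-Xᵀ) Y).PosSemidef)
    (Xhat : Matrix (Fin d × Fin n) (Fin ρ × Fin n) ℝ)
    (hXhat : Xhat = Matrix.of fun p q => Xb p.1 p.2 q)
    (W : Matrix (Fin ρ × Fin n) (Fin ρ × Fin n) ℝ)
    (hW : W = Matrix.of fun a b => ∫ τ in K,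
      ϖ τ * (((kronColIdRho d n ρ f τ)ᵀ * Y * kronColIdRho d n ρ f τ) a b))
    (Υ : Matrix (Fin d × Fin n) (Fin ρ × Fin n) ℝ)
    (z : Fin ρ × Fin n → ℝ) (hΥz : Υ *ᵥ z = ϑ) :
    z ⬝ᵥ (Υᵀ * Xhat + Xhatᵀ * Υ - W) *ᵥ z ≤ ϑ ⬝ᵥ (W₀⁻¹ ⊗ₖ U) *ᵥ ϑ := by
  have hint := aux_int d K ϖ hϖ hϖ0 f hf hfi
  set Θ : Fin d → Fin n → ℝ := fun i a => ϑ (i, a) with hΘ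
  set w : Fin d → Fin n → ℝ := fun i => ∑ j, W₀⁻¹ i j • Θ j with hw
  have hdet : IsUnit W₀.det := hW₀pd.det_pos.ne'.isUnit
  have hsymm : ∀ i k, W₀ i k = W₀ k i := by
    intro i k
    simp only [hW₀, Matrix.of_apply, mul_comm (f _ i)]
  have hWw : ∀ k, ∑ i, W₀ i k • w i = Θ k := by
    intro k
    have h1 : ∀ j, ∑ i, W₀ k i * W₀⁻¹ i j = (1 : Matrix (Fin d) (Fin d) ℝ) k j := by
      intro j
      rw [← Matrix.mul_nonsing_inv W₀ hdet, Matrix.mul_apply]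
    simp only [hw, Finset.smul_sum, smul_smul]
    rw [Finset.sum_comm]
    simp only [← Finset.sum_smul, hsymm _ k, h1]
    simp [Matrix.one_apply]
  set C : Fin d → Fin d → ℝ := fun i k =>
    w i ⬝ᵥ U *ᵥ w k - 2 * (w i ⬝ᵥ Xb k *ᵥ z) + ∑ a, ∑ b, z a * Y (i, a) (k, b) * z b with hCdef
  have hC : ∀ g : Fin d → ℝ, 0 ≤ ∑ i, ∑ k, g i * g k * C i k := by
    intro g
    have hp := hblock.dotProduct_mulVec_nonneg
      (Sum.elim (∑ i, g i • w i) (fun p => g p.1 * z p.2))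
    have hXv : X *ᵥ (fun p : Fin d × (Fin ρ × Fin n) => g p.1 * z p.2)
        = ∑ k, g k • (Xb k *ᵥ z) := by
      ext a
      simp only [hX, Matrix.mulVec, dotProduct, Matrix.of_apply, Finset.sum_apply, Pi.smul_apply,
        smul_eq_mul, Finset.mul_sum]
      rw [Fintype.sum_prod_type]
      exact Finset.sum_congr rfl fun k _ => Finset.sum_congr rfl fun b _ => by ring
    have hYv : (fun p : Fin d × (Fin ρ × Fin n) => g p.1 * z p.2) ⬝ᵥ
        Y *ᵥ (fun p : Fin d × (Fin ρ × Fin n) => g p.1 * z p.2)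
        = ∑ i, ∑ k, g i * g k * ∑ a, ∑ b, z a * Y (i, a) (k, b) * z b := by
      simp only [Matrix.mulVec, dotProduct, Finset.mul_sum]
      rw [Fintype.sum_prod_type]
      refine Finset.sum_congr rfl fun i _ => ?_
      rw [Finset.sum_comm]
      rw [Fintype.sum_prod_type]
      refine Finset.sum_congr rfl fun k _ => ?_
      rw [Finset.sum_comm]
      exact Finset.sum_congr rfl fun a _ => Finset.sum_congr rfl fun b _ => by ring
    rw [star_trivial, Matrix.fromBlocks_mulVec, sumElim_dotProduct_sumElim] at hp
    simp only [Sum.elim_comp_inl, Sum.elim_comp_inr, Matrix.neg_mulVec, dotProduct_add,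
      dotProduct_neg, hYv] at hp
    rw [Matrix.mulVec_transpose, dotProduct_comm _ (_ ᵥ* X), ← Matrix.dotProduct_mulVec, hXv] at hp
    have e1 : (∑ i, g i • w i) ⬝ᵥ U *ᵥ (∑ i, g i • w i)
        = ∑ i, ∑ k, g i * g k * (w i ⬝ᵥ U *ᵥ w k) := by
      simp only [Matrix.mulVec_sum, Matrix.mulVec_smul, sum_dotProduct, dotProduct_sum,
        smul_dotProduct, dotProduct_smul, smul_eq_mul, Finset.mul_sum]
      rw [Finset.sum_comm]
      exact Finset.sum_congr rfl fun i _ => Finset.sum_congr rfl fun k _ => by ring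
    have e2 : (∑ i, g i • w i) ⬝ᵥ (∑ k, g k • (Xb k *ᵥ z))
        = ∑ i, ∑ k, g i * g k * (w i ⬝ᵥ Xb k *ᵥ z) := by
      simp only [sum_dotProduct, dotProduct_sum,
        smul_dotProduct, dotProduct_smul, smul_eq_mul, Finset.mul_sum]
      rw [Finset.sum_comm]
      exact Finset.sum_congr rfl fun i _ => Finset.sum_congr rfl fun k _ => by ring
    rw [e1, e2] at hp
    have e3 : ∑ i, ∑ k, g i * g k * C i k = ∑ i, ∑ k, g i * g k * (w i ⬝ᵥ U *ᵥ w k)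
        - 2 * ∑ i, ∑ k, g i * g k * (w i ⬝ᵥ Xb k *ᵥ z)
        + ∑ i, ∑ k, g i * g k * ∑ a, ∑ b, z a * Y (i, a) (k, b) * z b := by
      rw [Finset.mul_sum]
      simp only [Finset.mul_sum (a := (2:ℝ)), ← Finset.sum_sub_distrib, ← Finset.sum_add_distrib]
      exact Finset.sum_congr rfl fun i _ => Finset.sum_congr rfl fun k _ => by
        simp only [hCdef]; ring
    rw [e3]
    linarith
  have key := aux_quad d K ϖ hϖ0 f hint C hC
  have hW₀e : ∀ i k, (∫ τ in K, ϖ τ * (f τ i * f τ k)) = W₀ i k := by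
    intro i k; rw [hW₀, Matrix.of_apply]
  simp only [hW₀e] at key
  have hWe : ∀ a b, W a b = ∑ i, ∑ k, W₀ i k * Y (i, a) (k, b) := by
    intro a b
    have hpt : ∀ τ, ϖ τ * (((kronColIdRho d n ρ f τ)ᵀ * Y * kronColIdRho d n ρ f τ) a b)
        = ∑ i, ∑ k, ϖ τ * (f τ i * f τ k) * Y (i, a) (k, b) := by
      intro τ
      simp only [Matrix.mul_apply, Matrix.transpose_apply, kronColIdRho, Matrix.of_apply,
        Fintype.sum_prod_type, Matrix.one_apply, mul_ite, ite_mul, mul_one, mul_zero, zero_mul,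
        Finset.sum_ite_eq', Finset.mem_univ, if_true, Finset.sum_mul, Finset.mul_sum]
      rw [Finset.sum_comm]
      exact Finset.sum_congr rfl fun i _ => Finset.sum_congr rfl fun k _ => by ring
    rw [hW, Matrix.of_apply]
    simp only [hpt]
    rw [integral_finsetSum]
    · refine Finset.sum_congr rfl fun i _ => ?_
      rw [integral_finsetSum]
      · refine Finset.sum_congr rfl fun k _ => ?_
        rw [integral_mul_const, hW₀e]
      · exact fun k _ => (hint i k).mul_const _
    · exact fun i _ => integrable_finsetSum _ fun k _ => (hint i k).mul_const _
  have k3 : ∑ i, ∑ k, W₀ i k * (∑ a, ∑ b, z a * Y (i, a) (k, b) * z b) = z ⬝ᵥ W *ᵥ z := by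
    simp only [Matrix.mulVec, dotProduct, hWe, Finset.mul_sum, Finset.sum_mul]
    have s1 : ∀ G : Fin d → Fin d → Fin ρ × Fin n → Fin ρ × Fin n → ℝ,
        ∑ i, ∑ k, ∑ a, ∑ b, G i k a b = ∑ a, ∑ b, ∑ i, ∑ k, G i k a b := by
      intro G
      calc _ = ∑ i, ∑ a, ∑ k, ∑ b, G i k a b :=
            Finset.sum_congr rfl fun i _ => Finset.sum_comm
        _ = ∑ a, ∑ i, ∑ k, ∑ b, G i k a b := Finset.sum_comm
        _ = ∑ a, ∑ i, ∑ b, ∑ k, G i k a b :=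
            Finset.sum_congr rfl fun a _ => Finset.sum_congr rfl fun i _ => Finset.sum_comm
        _ = _ := Finset.sum_congr rfl fun a _ => Finset.sum_comm
    rw [s1]
    refine Finset.sum_congr rfl fun a _ => Finset.sum_congr rfl fun b _ =>
      Finset.sum_congr rfl fun i _ => Finset.sum_congr rfl fun k _ => by ring
  have k0 : ∀ V : Fin d → Fin n → ℝ, ∑ i, ∑ k, W₀ i k * (w i ⬝ᵥ V k) = ∑ k, Θ k ⬝ᵥ V k := by
    intro V
    rw [Finset.sum_comm]
    refine Finset.sum_congr rfl fun k _ => ?_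
    rw [← hWw k, sum_dotProduct]
    simp only [smul_dotProduct, smul_eq_mul]
  have k1 : ∑ k, Θ k ⬝ᵥ U *ᵥ w k = ϑ ⬝ᵥ (W₀⁻¹ ⊗ₖ U) *ᵥ ϑ := by
    simp only [hw, Matrix.mulVec_sum, Matrix.mulVec_smul, dotProduct_sum, dotProduct_smul]
    simp only [Matrix.mulVec, dotProduct, Fintype.sum_prod_type, Matrix.kroneckerMap_apply,
      Finset.mul_sum, smul_eq_mul, hΘ]
    refine Finset.sum_congr rfl fun k _ => ?_
    rw [Finset.sum_comm]
    exact Finset.sum_congr rfl fun a _ => Finset.sum_congr rfl fun j _ =>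
      Finset.sum_congr rfl fun b _ => by ring
  have k2 : ∑ k, Θ k ⬝ᵥ Xb k *ᵥ z = ϑ ⬝ᵥ Xhat *ᵥ z := by
    simp only [Matrix.mulVec, dotProduct, Fintype.sum_prod_type, hXhat, Matrix.of_apply, hΘ]
  have e3 : ∑ i, ∑ k, W₀ i k * C i k = ∑ i, ∑ k, W₀ i k * (w i ⬝ᵥ U *ᵥ w k)
      - 2 * ∑ i, ∑ k, W₀ i k * (w i ⬝ᵥ Xb k *ᵥ z)
      + ∑ i, ∑ k, W₀ i k * ∑ a, ∑ b, z a * Y (i, a) (k, b) * z b := by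
    rw [Finset.mul_sum]
    simp only [Finset.mul_sum (a := (2:ℝ)), ← Finset.sum_sub_distrib, ← Finset.sum_add_distrib]
    exact Finset.sum_congr rfl fun i _ => Finset.sum_congr rfl fun k _ => by
      simp only [hCdef]; ring
  rw [e3, k3, k0 (fun k => U *ᵥ w k), k0 (fun k => Xb k *ᵥ z), k1, k2] at key
  have r1 : z ⬝ᵥ (Υᵀ * Xhat) *ᵥ z = ϑ ⬝ᵥ Xhat *ᵥ z := by
    rw [← Matrix.mulVec_mulVec, Matrix.dotProduct_mulVec, Matrix.vecMul_transpose, hΥz]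
  have r2 : z ⬝ᵥ (Xhatᵀ * Υ) *ᵥ z = ϑ ⬝ᵥ Xhat *ᵥ z := by
    rw [← Matrix.mulVec_mulVec, Matrix.dotProduct_mulVec, Matrix.vecMul_transpose, hΥz,
      dotProduct_comm]
  rw [Matrix.sub_mulVec, Matrix.add_mulVec, dotProduct_sub, dotProduct_add, r1, r2]
  linarith
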